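/- arXiv:0908.1757 — 2 statements merged into one kernel-verified Lean document; each statement's English description precedes it below -/
import Mathlib

section
/- Let E be a unital, not necessarily commutative, ring and let Q, P ∈ E. Set X := G − 1 and Y := H − 1 in M₂(E). Then X·Y = Y·X = −X − Y. -/
/-- With `G`, `H` as in the construction of the index morphism,
the elements `X = G − 1` and `Y = H − 1` of `M₂(E)` satisfy the suspension
algebra relation `X·Y = Y·X = −X − Y`. -/
theorem stmt4 (E : Type*) [Ring E] (Q P : E)
    (G H X Y : Matrix (Fin 2) (Fin 2) E)
    (hG : G = !![Q, 1 - Q * P; P * Q - 1, P + P * (1 - Q * P)])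
    (hH : H = !![P + P * (1 - Q * P), P * Q - 1; 1 - Q * P, Q])
    (hX : X = G - 1) (hY : Y = H - 1) :
    X * Y = -X - Y ∧ Y * X = -X - Y := by
  have hGH : G * H = 1 := by
    subst hG hH
    ext i j
    fin_cases i <;> fin_cases j <;> simp [Matrix.mul_apply, Fin.sum_univ_two] <;> noncomm_ring
  have hHG : H * G = 1 := by
    subst hG hH
    ext i j
    fin_cases i <;> fin_cases j <;> simp [Matrix.mul_apply, Fin.sum_univ_two] <;> noncomm_ring
  subst hX hY
  constructor
  · rw [sub_mul, mul_sub, hGH]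
    noncomm_ring
  · rw [sub_mul, mul_sub, hHG]
    noncomm_ring
end

section
/- Let ev₁ : ℂ[z, z⁻¹] → ℂ be the unique ℂ-algebra homomorphism from the ring of Laurent polynomials over ℂ sending z to 1, and set u := z − 1 and v := z⁻¹ − 1. Then u·v = v·u = −u − v, and the kernel of ev₁ is equal to the smallest non-unital ℂ-subalgebra of ℂ[z, z⁻¹] containing u and v (i.e., the non-unital subalgebra generated by u and v). -/
open LaurentPolynomial

namespace LaurentPolynomial

variable {R : Type*} [CommRing R]

theorem T_sub_one_mem_adjoin (n : ℤ) :
    (T n - 1 : R[T;T⁻¹]) ∈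
      NonUnitalAlgebra.adjoin R ({T 1 - 1, T (-1) - 1} : Set R[T;T⁻¹]) := by
  set S := NonUnitalAlgebra.adjoin R ({T 1 - 1, T (-1) - 1} : Set R[T;T⁻¹])
  have hu : (T 1 - 1 : R[T;T⁻¹]) ∈ S := NonUnitalAlgebra.subset_adjoin R (by simp)
  have hv : (T (-1) - 1 : R[T;T⁻¹]) ∈ S := NonUnitalAlgebra.subset_adjoin R (by simp)
  have step (m k : ℤ) (hm : (T m - 1 : R[T;T⁻¹]) ∈ S) (hk : (T k - 1 : R[T;T⁻¹]) ∈ S) :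
      (T (m + k) - 1 : R[T;T⁻¹]) ∈ S := by
    have h : (T (m + k) - 1 : R[T;T⁻¹]) =
        (T m - 1) * (T k - 1) + (T m - 1) + (T k - 1) := by
      rw [T_add]; ring
    rw [h]
    exact add_mem (add_mem (mul_mem hm hk) hm) hk
  induction n with
  | zero => simp
  | succ n ih => exact step _ _ ih hu
  | pred n ih => exact step _ _ ih hv

theorem algHom_T_eq_one {A : Type*} [Semiring A] [Algebra R A] (φ : R[T;T⁻¹] →ₐ[R] A)
    (h : φ (T 1) = 1) (n : ℤ) : φ (T n) = 1 := by
  have hinv : φ (T (-1)) = 1 := by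
    rw [← one_mul (φ (T (-1))), ← h, ← map_mul, ← T_add, add_neg_cancel, T_zero, map_one, h]
  induction n with
  | zero => simp
  | succ n ih => rw [T_add, map_mul, ih, h, one_mul]
  | pred n ih => rw [sub_eq_add_neg, T_add, map_mul, ih, hinv, one_mul]

theorem sub_C_mem_adjoin (φ : R[T;T⁻¹] →ₐ[R] R) (h : φ (T 1) = 1) (f : R[T;T⁻¹]) :
    f - C (φ f) ∈ NonUnitalAlgebra.adjoin R ({T 1 - 1, T (-1) - 1} : Set R[T;T⁻¹]) := by
  induction f using LaurentPolynomial.induction_on' with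
  | add p q hp hq =>
    rw [map_add, map_add, add_sub_add_comm]
    exact add_mem hp hq
  | C_mul_T n a =>
    have hφ : φ (C a * T n) = a := by
      rw [← smul_eq_C_mul, map_smul, algHom_T_eq_one φ h, smul_eq_mul, mul_one]
    rw [hφ, show C a * T n - C a = a • (T n - 1 : R[T;T⁻¹]) by rw [smul_eq_C_mul]; ring]
    exact SMulMemClass.smul_mem a (T_sub_one_mem_adjoin n)

end LaurentPolynomial

/-- Let `ev₁` be the unique ℂ-algebra homomorphism from the ring of
Laurent polynomials `ℂ[z,z⁻¹]` to `ℂ` sending `z` to `1`, and set `u = z − 1`,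
`v = z⁻¹ − 1`.  Then `u·v = v·u = −u − v`, and the kernel of `ev₁` equals the
smallest non-unital ℂ-subalgebra of `ℂ[z,z⁻¹]` containing `u` and `v`. -/
theorem stmt5 (ev₁ : LaurentPolynomial ℂ →ₐ[ℂ] ℂ) (hev : ev₁ (T 1) = 1)
    (u v : LaurentPolynomial ℂ) (hu : u = T 1 - 1) (hv : v = T (-1) - 1) :
    u * v = -u - v ∧ v * u = -u - v ∧
    (RingHom.ker (ev₁ : LaurentPolynomial ℂ →+* ℂ) : Set (LaurentPolynomial ℂ)) =
      (NonUnitalAlgebra.adjoin ℂ ({u, v} : Set (LaurentPolynomial ℂ)) :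
        Set (LaurentPolynomial ℂ)) := by
  subst hu hv
  have huv : (T 1 - 1) * (T (-1) - 1) = -(T 1 - 1) - (T (-1) - 1 : LaurentPolynomial ℂ) := by
    have hT : (T 1 * T (-1) : LaurentPolynomial ℂ) = 1 := by rw [← T_add]; simp
    linear_combination hT
  refine ⟨huv, by rw [mul_comm, huv], Set.Subset.antisymm (fun f hf => ?_) (fun f hf => ?_)⟩
  · have hf' : ev₁ f = 0 := hf
    simpa [hf'] using sub_C_mem_adjoin ev₁ hev f
  · change ev₁ f = 0
    induction hf using NonUnitalAlgebra.adjoin_induction with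
    | mem x hx =>
      rcases hx with rfl | rfl <;> simp [algHom_T_eq_one ev₁ hev]
    | add x y _ _ hx hy => rw [map_add, hx, hy, add_zero]
    | zero => exact map_zero ev₁
    | mul x y _ _ hx _ => rw [map_mul, hx, zero_mul]
    | smul r x _ hx => rw [map_smul, hx, smul_zero]
end
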